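/- Let F be a binary relation on a finite set X. The map C(A, A') := A ∩ A'* on the lattice of attractors of F, where A'* := α((A')ᶜ) is the dual repeller, is a monotone distributive lattice form: it satisfies absorption, distributivity C(A∧C', B∨D) = C(A,B) ∩ C(C',D) computed via Inv, and monotonicity (A ∩ A'* = ∅ implies A ⊆ A'). -/

import Mathlib

/-- Image of a set under a binary relation. -/
def imageRel {X : Type*} (F : X → X → Prop) (U : Set X) : Set X :=
  {y | ∃ x ∈ U, F x y}

/-- Preimage of a set under a binary relation. -/
def preRel {X : Type*} (F : X → X → Prop) (U : Set X) : Set X :=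
  {x | ∃ y ∈ U, F x y}

/-- Omega limit set of a set under a binary relation. -/
def omegaRel {X : Type*} (F : X → X → Prop) (U : Set X) : Set X :=
  ⋂ k : ℕ, ⋃ n ≥ k, (imageRel F)^[n] U

/-- Alpha limit set of a set under a binary relation. -/
def alphaRel {X : Type*} (F : X → X → Prop) (U : Set X) : Set X :=
  ⋂ k : ℕ, ⋃ n ≥ k, (preRel F)^[n] U

/-- The maximal invariant set inside a set `W`. -/
def invRel {X : Type*} (F : X → X → Prop) (W : Set X) : Set X :=
  ⋃₀ {S | S ⊆ W ∧ S ⊆ imageRel F S ∧ S ⊆ preRel F S}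

/-- The dual repeller of an attractor `A`. -/
def dualRep {X : Type*} (F : X → X → Prop) (A : Set X) : Set X :=
  alphaRel F Aᶜ

lemma imageRel_mono {X : Type*} (F : X → X → Prop) : Monotone (imageRel F) :=
  fun _ _ h _ ⟨x, hx, hxy⟩ => ⟨x, h hx, hxy⟩

lemma preRel_mono {X : Type*} (F : X → X → Prop) : Monotone (preRel F) :=
  imageRel_mono (flip F)

/-- The complement of a forward invariant set is backward invariant. -/
lemma preRel_compl_subset {X : Type*} {F : X → X → Prop} {A : Set X} (h : imageRel F A ⊆ A) :
    preRel F Aᶜ ⊆ Aᶜ :=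
  fun _ ⟨_, hy, hxy⟩ hx => hy (h ⟨_, hx, hxy⟩)

lemma omegaRel_mono {X : Type*} (F : X → X → Prop) : Monotone (omegaRel F) :=
  fun _ _ h => Set.iInter_mono fun _ => Set.iUnion₂_mono fun n _ =>
    (imageRel_mono F).iterate n h

/-- On a finite set, the iterates of a forward invariant set reach its omega limit set. -/
lemma exists_iterate_imageRel_eq_omegaRel {X : Type*} [Finite X] {F : X → X → Prop} {U : Set X}
    (h : imageRel F U ⊆ U) : ∃ N, ∀ n ≥ N, (imageRel F)^[n] U = omegaRel F U := by
  have hanti : Antitone fun n => (imageRel F)^[n] U :=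
    (imageRel_mono F).antitone_iterate_of_map_le h
  obtain ⟨N, hN⟩ := WellFoundedGT.monotone_chain_condition
    (⟨fun n => OrderDual.toDual ((imageRel F)^[n] U), fun _ _ hab => hanti hab⟩ :
      ℕ →o (Set X)ᵒᵈ)
  replace hN : ∀ n ≥ N, (imageRel F)^[N] U = (imageRel F)^[n] U := hN
  refine ⟨N, fun n hn => ?_⟩
  rw [← hN n hn]
  refine subset_antisymm (fun x hx => ?_) fun x hx => ?_
  · refine Set.mem_iInter.2 fun k => Set.mem_iUnion₂.2 ⟨max N k, le_max_right _ _, ?_⟩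
    rwa [← hN _ (le_max_left _ _)]
  · obtain ⟨m, hm, hxm⟩ := Set.mem_iUnion₂.1 (Set.mem_iInter.1 hx N)
    rwa [hN m hm]

lemma omegaRel_subset {X : Type*} {F : X → X → Prop} {U : Set X}
    (h : imageRel F U ⊆ U) : omegaRel F U ⊆ U := fun x hx => by
  obtain ⟨m, -, hxm⟩ := Set.mem_iUnion₂.1 (Set.mem_iInter.1 hx 0)
  exact (imageRel_mono F).antitone_iterate_of_map_le h (Nat.zero_le m) hxm

lemma imageRel_omegaRel {X : Type*} [Finite X] {F : X → X → Prop} {U : Set X}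
    (h : imageRel F U ⊆ U) : imageRel F (omegaRel F U) = omegaRel F U := by
  obtain ⟨N, hN⟩ := exists_iterate_imageRel_eq_omegaRel h
  conv_lhs => rw [← hN N le_rfl]
  rw [← Function.iterate_succ_apply' (imageRel F), hN _ N.le_succ]

lemma subset_iterate_imageRel {X : Type*} {F : X → X → Prop} {S : Set X}
    (h : S ⊆ imageRel F S) (n : ℕ) : S ⊆ (imageRel F)^[n] S :=
  (imageRel_mono F).monotone_iterate_of_le_map h (Nat.zero_le n)

lemma subset_omegaRel {X : Type*} {F : X → X → Prop} {S U : Set X}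
    (h : S ⊆ imageRel F S) (hU : S ⊆ U) : S ⊆ omegaRel F U := fun _ hx =>
  Set.mem_iInter.2 fun k => Set.mem_iUnion₂.2
    ⟨k, le_rfl, (imageRel_mono F).iterate k hU (subset_iterate_imageRel h k hx)⟩

lemma disjoint_preRel_iff {X : Type*} {F : X → X → Prop} {V S : Set X} :
    Disjoint (preRel F V) S ↔ Disjoint V (imageRel F S) := by
  simp only [Set.disjoint_left]
  exact ⟨fun h y hy ⟨x, hx, hxy⟩ => h ⟨y, hy, hxy⟩ hx,
    fun h x ⟨y, hy, hxy⟩ hx => h hy ⟨x, hx, hxy⟩⟩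

lemma disjoint_iterate_preRel_iff {X : Type*} {F : X → X → Prop} {V S : Set X} (n : ℕ) :
    Disjoint ((preRel F)^[n] V) S ↔ Disjoint V ((imageRel F)^[n] S) := by
  induction n generalizing S with
  | zero => rfl
  | succ n ih =>
    rw [Function.iterate_succ_apply', disjoint_preRel_iff, ih, Function.iterate_succ_apply]

lemma inter_iterate_preRel_subset {X : Type*} {F : X → X → Prop} {A : Set X}
    (h : imageRel F A ⊆ A) (V : Set X) (n : ℕ) :
    A ∩ (preRel F)^[n] V ⊆ (preRel F)^[n] (A ∩ V) := by
  induction n with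
  | zero => rfl
  | succ n ih =>
    rw [Function.iterate_succ_apply', Function.iterate_succ_apply']
    rintro x ⟨hx, y, hy, hxy⟩
    exact ⟨y, ih ⟨h ⟨x, hx, hxy⟩, hy⟩, hxy⟩

lemma imageRel_inter_subset {X : Type*} {F : X → X → Prop} {A B : Set X}
    (hA : imageRel F A ⊆ A) (hB : imageRel F B ⊆ B) : imageRel F (A ∩ B) ⊆ A ∩ B :=
  fun _ ⟨x, hx, hxy⟩ => ⟨hA ⟨x, hx.1, hxy⟩, hB ⟨x, hx.2, hxy⟩⟩

lemma dualRep_anti {X : Type*} (F : X → X → Prop) : Antitone (dualRep F) :=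
  fun _ _ h => omegaRel_mono (flip F) (Set.compl_subset_compl.2 h)

lemma dualRep_subset_compl {X : Type*} {F : X → X → Prop} {A : Set X}
    (h : imageRel F A ⊆ A) : dualRep F A ⊆ Aᶜ :=
  omegaRel_subset (F := flip F) (preRel_compl_subset h)

lemma preRel_dualRep {X : Type*} [Finite X] {F : X → X → Prop} {A : Set X}
    (h : imageRel F A ⊆ A) : preRel F (dualRep F A) = dualRep F A :=
  imageRel_omegaRel (F := flip F) (preRel_compl_subset h)

/-- On a finite set, the backward iterates of the complement reach the dual repeller. -/
lemma exists_iterate_preRel_compl_eq_dualRep {X : Type*} [Finite X] {F : X → X → Prop}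
    {A : Set X} (h : imageRel F A ⊆ A) :
    ∃ N, ∀ n ≥ N, (preRel F)^[n] Aᶜ = dualRep F A :=
  exists_iterate_imageRel_eq_omegaRel (F := flip F) (preRel_compl_subset h)

lemma inter_dualRep_omegaRel_inter {X : Type*} [Finite X] {F : X → X → Prop} {A B : Set X}
    (hA : imageRel F A ⊆ A) (hB : imageRel F B ⊆ B) :
    A ∩ dualRep F (omegaRel F (A ∩ B)) = A ∩ dualRep F B := by
  have hAB := imageRel_inter_subset hA hB
  refine subset_antisymm ?_ <| Set.inter_subset_inter_right A <| dualRep_anti F <|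
    (omegaRel_subset hAB).trans Set.inter_subset_right
  obtain ⟨N, hN⟩ := exists_iterate_imageRel_eq_omegaRel hAB
  obtain ⟨M, hM⟩ := exists_iterate_preRel_compl_eq_dualRep (imageRel_omegaRel hAB).subset
  obtain ⟨K, hK⟩ := exists_iterate_preRel_compl_eq_dualRep hB
  have hdisj : (preRel F)^[N] (omegaRel F (A ∩ B))ᶜ ⊆ (A ∩ B)ᶜ := by
    rw [Set.subset_compl_iff_disjoint_right, disjoint_iterate_preRel_iff, hN N le_rfl]
    exact disjoint_compl_left
  rintro x ⟨hxA, hx⟩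
  refine ⟨hxA, ?_⟩
  rw [← hM (max M K + N) (by omega), Function.iterate_add_apply] at hx
  rw [← hK (max M K) (le_max_right _ _)]
  have hsub : A ∩ (A ∩ B)ᶜ ⊆ Bᶜ := fun y hy hyB => hy.2 ⟨hy.1, hyB⟩
  refine (preRel_mono F).iterate _ hsub
    (inter_iterate_preRel_subset hA (A ∩ B)ᶜ _ ⟨hxA, ?_⟩)
  exact (preRel_mono F).iterate _ hdisj hx

lemma omegaRel_inter_dualRep_union {X : Type*} [Finite X] {F : X → X → Prop}
    {A B C D : Set X} (hA : imageRel F A ⊆ A) (hB : imageRel F B ⊆ B)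
    (hC : imageRel F C ⊆ C) (hD : imageRel F D ⊆ D) :
    omegaRel F (A ∩ C) ∩ dualRep F (B ∪ D) =
      invRel F ((A ∩ dualRep F B) ∩ (C ∩ dualRep F D)) := by
  have hAC := imageRel_inter_subset hA hC
  have hBD : imageRel F (B ∪ D) ⊆ B ∪ D := fun y ⟨x, hx, hxy⟩ =>
    hx.imp (fun h => hB ⟨x, h, hxy⟩) fun h => hD ⟨x, h, hxy⟩
  have hω := imageRel_omegaRel hAC
  have hα := preRel_dualRep hBD
  refine subset_antisymm (Set.subset_sUnion_of_mem ⟨?_, ?_, ?_⟩) (Set.sUnion_subset ?_)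
  · rintro x ⟨hx, hx'⟩
    have := omegaRel_subset hAC hx
    exact ⟨⟨this.1, dualRep_anti F Set.subset_union_left hx'⟩,
      this.2, dualRep_anti F Set.subset_union_right hx'⟩
  · rintro y ⟨hy, hy'⟩
    obtain ⟨x, hx, hxy⟩ := hω.superset hy
    exact ⟨x, ⟨hx, hα.subset ⟨y, hy', hxy⟩⟩, hxy⟩
  · rintro x ⟨hx, hx'⟩
    obtain ⟨y, hy, hxy⟩ := hα.superset hx'
    exact ⟨y, ⟨hω.subset ⟨x, hx, hxy⟩, hy⟩, hxy⟩
  · rintro S ⟨hS, hSi, hSp⟩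
    refine Set.subset_inter (subset_omegaRel hSi fun x hx => ⟨(hS hx).1.1, (hS hx).2.1⟩)
      (subset_omegaRel (F := flip F) hSp fun x hx => ?_)
    rintro (hxB | hxD)
    · exact dualRep_subset_compl hB (hS hx).1.2 hxB
    · exact dualRep_subset_compl hD (hS hx).2.2 hxD

lemma subset_of_inter_dualRep_eq_empty {X : Type*} [Finite X] {F : X → X → Prop}
    {A B : Set X} (hA : A ⊆ imageRel F A) (hB : imageRel F B ⊆ B)
    (h : A ∩ dualRep F B = ∅) : A ⊆ B := by
  obtain ⟨N, hN⟩ := exists_iterate_preRel_compl_eq_dualRep hB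
  have hdisj : Disjoint Bᶜ ((imageRel F)^[N] A) := by
    rw [← disjoint_iterate_preRel_iff, hN N le_rfl, disjoint_comm]
    exact Set.disjoint_iff_inter_eq_empty.2 h
  exact (subset_iterate_imageRel hA N).trans (Set.disjoint_compl_left_iff_subset.1 hdisj)

/-- `C(A,A') = A ∩ A'*` is a monotone distributive lattice form (the Conley
form) on the lattice of attractors of a finite binary relation. -/
theorem combinatorial_conley_form {X : Type*} [Finite X] (F : X → X → Prop) :
    (∀ A B : Set X, imageRel F A = A → imageRel F B = B →
      (A ∪ B) ∩ dualRep F A = B ∩ dualRep F A) ∧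
    (∀ A B : Set X, imageRel F A = A → imageRel F B = B →
      A ∩ dualRep F (omegaRel F (A ∩ B)) = A ∩ dualRep F B) ∧
    (∀ A B C' D : Set X, imageRel F A = A → imageRel F B = B →
      imageRel F C' = C' → imageRel F D = D →
      omegaRel F (A ∩ C') ∩ dualRep F (B ∪ D) =
        invRel F ((A ∩ dualRep F B) ∩ (C' ∩ dualRep F D))) ∧
    (∀ A A' : Set X, imageRel F A = A → imageRel F A' = A' →
      A ∩ dualRep F A' = ∅ → A ⊆ A') := by
  refine ⟨fun A B hA _ => ?_, fun A B hA hB => inter_dualRep_omegaRel_inter hA.subset hB.subset,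
    fun A B C' D hA hB hC hD =>
      omegaRel_inter_dualRep_union hA.subset hB.subset hC.subset hD.subset,
    fun A A' hA hA' => subset_of_inter_dualRep_eq_empty hA.superset hA'.subset⟩
  have hdisj : A ∩ dualRep F A = ∅ := Set.disjoint_iff_inter_eq_empty.1 <|
    (Set.subset_compl_iff_disjoint_left.1 (dualRep_subset_compl hA.subset))
  rw [Set.union_inter_distrib_right, hdisj, Set.empty_union]
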